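/- arXiv:2503.02514 — 3 statements merged into one kernel-verified Lean document; each statement's English description precedes it below -/
import Mathlib

section
/- Let τ be an F-stopping time with values in [t,T]. Then there exist a sequence of natural numbers (N_n), and a sequence (τ_n) of F-stopping times with values in [t,T] converging to τ P-almost surely, such that for every n one has τ_n = Σ_{i=1}^{N_n} τ_{n,i}·1_{G_{n,i}}, where each τ_{n,i} is an H-stopping time with values in [t,T] and {G_{n,1},…,G_{n,N_n}} ⊆ G is a partition of Ω. -/
open MeasureTheory Filter Set
open scoped symmDiff ENNReal

/-- The sets of the form `{ω | ω ∈ D (p ω)}`, where `p` is a `G`-measurable map to a finite type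
and every `D i` is `K`-measurable: finite unions of rectangles `A ∩ B` with `A ∈ G`, `B ∈ K`. -/
def finiteRectangleUnions {Ω : Type*} (G K : MeasurableSpace Ω) : Set (Set Ω) :=
  {B | ∃ (ι : Type) (_ : Finite ι) (p : Ω → ι) (D : ι → Set Ω),
    (∀ i, MeasurableSet[G] (p ⁻¹' {i})) ∧ (∀ i, MeasurableSet[K] (D i)) ∧
      B = {ω | ω ∈ D (p ω)}}

section FiniteRectangleUnions

variable {Ω : Type*} {G K : MeasurableSpace Ω}

lemma mem_finiteRectangleUnions_of_left {s : Set Ω} (hs : MeasurableSet[G] s) :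
    s ∈ finiteRectangleUnions G K := by
  refine ⟨Prop, inferInstance, fun ω => ω ∈ s, fun q => {_ω | q}, fun q => ?_, fun q => ?_, rfl⟩
  · by_cases hq : q
    · convert hs using 1
      ext ω
      simp [hq]
    · convert hs.compl using 1
      ext ω
      simp [hq]
  · exact MeasurableSet.const q

lemma mem_finiteRectangleUnions_of_right {s : Set Ω} (hs : MeasurableSet[K] s) :
    s ∈ finiteRectangleUnions G K :=
  ⟨Unit, inferInstance, fun _ => (), fun _ => s, fun _ => by simp, fun _ => hs, rfl⟩

lemma isSetAlgebra_finiteRectangleUnions : IsSetAlgebra (finiteRectangleUnions G K) where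
  empty_mem := mem_finiteRectangleUnions_of_left (@MeasurableSet.empty _ G)
  compl_mem := by
    rintro _ ⟨ι, hι, p, D, hp, hD, rfl⟩
    exact ⟨ι, hι, p, fun i => (D i)ᶜ, hp, fun i => (hD i).compl, rfl⟩
  union_mem := by
    rintro _ _ ⟨ι, hι, p, D, hp, hD, rfl⟩ ⟨κ, hκ, q, E, hq, hE, rfl⟩
    refine ⟨ι × κ, inferInstance, fun ω => (p ω, q ω), fun i => D i.1 ∪ E i.2, fun i => ?_,
      fun i => (hD i.1).union (hE i.2), rfl⟩
    convert (hp i.1).inter (hq i.2) using 1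
    ext ω
    simp [Prod.ext_iff]

lemma sup_eq_generateFrom_finiteRectangleUnions :
    G ⊔ K = MeasurableSpace.generateFrom (finiteRectangleUnions G K) := by
  apply le_antisymm
  · exact sup_le
      (fun s hs => MeasurableSpace.measurableSet_generateFrom
        (mem_finiteRectangleUnions_of_left hs))
      (fun s hs => MeasurableSpace.measurableSet_generateFrom
        (mem_finiteRectangleUnions_of_right hs))
  · refine MeasurableSpace.generateFrom_le ?_
    rintro _ ⟨ι, hι, p, D, hp, hD, rfl⟩
    have h : {ω | ω ∈ D (p ω)} = ⋃ i, p ⁻¹' {i} ∩ D i := by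
      ext ω
      simp
    rw [h]
    exact MeasurableSet.iUnion fun i =>
      ((le_sup_left : G ≤ G ⊔ K) _ (hp i)).inter ((le_sup_right : K ≤ G ⊔ K) _ (hD i))

lemma exists_finiteRectangleUnions_measure_symmDiff_lt {m : MeasurableSpace Ω} (P : Measure Ω)
    [IsFiniteMeasure P] (hG : G ≤ m) (hK : K ≤ m) {A : Set Ω} (hA : MeasurableSet[G ⊔ K] A)
    {ε : ℝ≥0∞} (hε : 0 < ε) : ∃ B ∈ finiteRectangleUnions G K, P (B ∆ A) < ε := by
  have hle : G ⊔ K ≤ m := sup_le hG hK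
  have : IsFiniteMeasure (P.trim hle) := isFiniteMeasure_trim hle
  obtain ⟨B, hB, hlt⟩ := @exists_measure_symmDiff_lt_of_generateFrom_isSetRing Ω (G ⊔ K)
    (P.trim hle) this _ isSetAlgebra_finiteRectangleUnions.isSetRing
    ⟨{univ}, countable_singleton _,
      singleton_subset_iff.2 isSetAlgebra_finiteRectangleUnions.univ_mem, by simp⟩
    sup_eq_generateFrom_finiteRectangleUnions _ hA _ hε
  exact ⟨B, hB, (le_trim hle).trans_lt hlt⟩

end FiniteRectangleUnions

/-- An `F`-stopping time is approximated, in probability, by an `H`-stopping time chosen according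
to a finite `G`-measurable partition. -/
lemma exists_piecewise_stoppingTime_approx {Ω : Type*} {m : MeasurableSpace Ω} (P : Measure Ω)
    [IsFiniteMeasure P] {t T : ℝ} (htT : t ≤ T) {H : ℝ → MeasurableSpace Ω}
    (hH_le : ∀ s ∈ Icc t T, H s ≤ m)
    (hH_mono : ∀ ⦃s u : ℝ⦄, s ∈ Icc t T → u ∈ Icc t T → s ≤ u → H s ≤ H u)
    {G : MeasurableSpace Ω} (hG_le : G ≤ m) {τ : Ω → ℝ} (hτ_mem : ∀ ω, τ ω ∈ Icc t T)
    (hτ_st : ∀ s ∈ Icc t T, MeasurableSet[G ⊔ H s] {ω | τ ω ≤ s})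
    {δ : ℝ} (hδ : 0 < δ) {ε : ℝ≥0∞} (hε : 0 < ε) :
    ∃ (N : ℕ) (p : Ω → Fin N) (σ : Fin N → Ω → ℝ),
      (∀ i, MeasurableSet[G] (p ⁻¹' {i})) ∧
      (∀ i, (∀ ω, σ i ω ∈ Icc t T) ∧ ∀ s ∈ Icc t T, MeasurableSet[H s] {ω | σ i ω ≤ s}) ∧
      P {ω | δ < |σ (p ω) ω - τ ω|} ≤ ε := by
  classical
  set K := ⌈(T - t) / δ⌉₊
  let g : Fin (K + 1) → ℝ := fun k => min (t + k * δ) T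
  have hg : ∀ k, g k ∈ Icc t T := fun k =>
    ⟨le_min (le_add_of_nonneg_right (by positivity)) htT, min_le_right _ _⟩
  obtain ⟨ε', hε', hsum⟩ := ENNReal.exists_pos_sum_of_countable' hε.ne' (Fin (K + 1))
  have happrox := fun k => exists_finiteRectangleUnions_measure_symmDiff_lt P hG_le
    (hH_le _ (hg k)) (hτ_st _ (hg k)) (hε' k)
  choose B hB hPB using happrox
  choose ι hι q D hq hD hBD using hB
  obtain ⟨N, ⟨e⟩⟩ := Finite.exists_equiv_fin (∀ k, ι k)
  let σ : (∀ k, ι k) → Ω → ℝ := fun i ω =>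
    Finset.univ.inf' Finset.univ_nonempty fun k => if ω ∈ D k (i k) then g k else T
  refine ⟨N, fun ω => e fun k => q k ω, fun i => σ (e.symm i), fun i => ?_,
    fun i => ⟨fun ω => ⟨?_, ?_⟩, fun s hs => ?_⟩, ?_⟩
  · have h : (fun ω => e fun k => q k ω) ⁻¹' {i} = ⋂ k, q k ⁻¹' {e.symm i k} := by
      ext ω
      simp [← Equiv.eq_symm_apply, funext_iff]
    rw [h]
    exact MeasurableSet.iInter fun k => hq k _
  · refine (Finset.le_inf'_iff _ _).2 fun k _ => ?_
    split_ifs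
    exacts [(hg k).1, htT]
  · refine (Finset.inf'_le _ (Finset.mem_univ 0)).trans ?_
    split_ifs
    exacts [(hg 0).2, le_rfl]
  · have h : {ω | σ (e.symm i) ω ≤ s} =
        ⋃ k, {ω | (if ω ∈ D k (e.symm i k) then g k else T) ≤ s} := by
      ext ω
      simp [σ]
    rw [h]
    refine MeasurableSet.iUnion fun k => ?_
    by_cases hT : T ≤ s
    · convert MeasurableSet.univ using 1
      refine eq_univ_of_forall fun ω => ?_
      rw [mem_ofPred_eq]
      split_ifs
      exacts [(hg k).2.trans hT, hT]
    · by_cases hk : g k ≤ s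
      · convert hH_mono (hg k) hs hk _ (hD k (e.symm i k)) using 1
        ext ω
        by_cases hω : ω ∈ D k (e.symm i k) <;> simp [hω, hk, hT]
      · convert MeasurableSet.empty using 1
        ext ω
        by_cases hω : ω ∈ D k (e.symm i k) <;> simp [hω, hk, hT]
  · refine le_trans (measure_mono (t := ⋃ k, B k ∆ {ω | τ ω ≤ g k}) ?_)
      ((measure_iUnion_le _).trans ((ENNReal.tsum_le_tsum fun k => (hPB k).le).trans hsum.le))
    intro ω
    contrapose
    intro hω
    have hmem : ∀ k, ω ∈ D k (q k ω) ↔ τ ω ≤ g k := by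
      intro k
      have h := fun h => hω (mem_iUnion.2 ⟨k, h⟩)
      rw [mem_symmDiff, hBD k] at h
      simp only [mem_ofPred_eq] at h
      tauto
    rw [mem_ofPred_eq, not_lt]
    simp only [Equiv.symm_apply_apply, σ, hmem]
    rw [abs_le]
    obtain ⟨hτt, hτT⟩ := hτ_mem ω
    constructor
    · have h : τ ω ≤ Finset.univ.inf' Finset.univ_nonempty
          fun k => if τ ω ≤ g k then g k else T := by
        refine (Finset.le_inf'_iff _ _).2 fun k _ => ?_
        split_ifs with hk
        exacts [hk, hτT]
      linarith
    · rw [sub_le_iff_le_add, Finset.inf'_le_iff]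
      have hn : ⌈(τ ω - t) / δ⌉₊ < K + 1 := Nat.lt_succ_of_le (Nat.ceil_mono (by gcongr))
      have hlow : τ ω - t ≤ ⌈(τ ω - t) / δ⌉₊ * δ := (div_le_iff₀ hδ).1 (Nat.le_ceil _)
      have hup : ⌈(τ ω - t) / δ⌉₊ * δ ≤ τ ω - t + δ := by
        have h := (Nat.ceil_lt_add_one (div_nonneg (sub_nonneg.2 hτt) hδ.le)).le
        calc _ ≤ ((τ ω - t) / δ + 1) * δ := by gcongr
          _ = _ := by field_simp
      refine ⟨⟨_, hn⟩, Finset.mem_univ _, ?_⟩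
      rw [if_pos (le_min (by linarith) hτT)]
      exact (min_le_left _ _).trans (by linarith)

/-- **Approximation of stopping times.** Setting: `(Ω, 𝓕, P)` a probability space,
`0 ≤ t ≤ T`, `H` a filtration on `[t,T]`, `G` a sub-σ-algebra independent of `H T`,
`F s := G ⊔ H s`. Every `[t,T]`-valued `F`-stopping time `τ` is the a.s. limit of
`F`-stopping times of the form `τ_n = Σ_{i} τ_{n,i} 1_{G_{n,i}}` with `τ_{n,i}`
`[t,T]`-valued `H`-stopping times and `{G_{n,i}}_i ⊆ G` a partition of `Ω`. -/
theorem stmt0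
    {Ω : Type*} {m𝓕 : MeasurableSpace Ω} (P : Measure Ω) [IsProbabilityMeasure P]
    (t T : ℝ) (ht0 : 0 ≤ t) (htT : t ≤ T)
    (H : ℝ → MeasurableSpace Ω)
    (hH_le : ∀ s ∈ Set.Icc t T, H s ≤ m𝓕)
    (hH_mono : ∀ ⦃s u : ℝ⦄, s ∈ Set.Icc t T → u ∈ Set.Icc t T → s ≤ u → H s ≤ H u)
    (G : MeasurableSpace Ω) (hG_le : G ≤ m𝓕)
    (hindep : ProbabilityTheory.Indep G (H T) P)
    (F : ℝ → MeasurableSpace Ω) (hF : ∀ s, F s = G ⊔ H s)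
    (τ : Ω → ℝ)
    (hτ_mem : ∀ ω, τ ω ∈ Set.Icc t T)
    (hτ_st : ∀ s ∈ Set.Icc t T, MeasurableSet[F s] {ω | τ ω ≤ s}) :
    ∃ (N : ℕ → ℕ) (τs : (n : ℕ) → Fin (N n) → Ω → ℝ) (Gs : (n : ℕ) → Fin (N n) → Set Ω),
      -- each τ_{n,i} is a [t,T]-valued H-stopping time
      (∀ n i, (∀ ω, τs n i ω ∈ Set.Icc t T) ∧
        ∀ s ∈ Set.Icc t T, MeasurableSet[H s] {ω | τs n i ω ≤ s}) ∧
      -- {G_{n,1},…,G_{n,N_n}} ⊆ G is a partition of Ω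
      (∀ n i, MeasurableSet[G] (Gs n i)) ∧
      (∀ n, Pairwise (Function.onFun Disjoint (Gs n))) ∧
      (∀ n, (⋃ i, Gs n i) = Set.univ) ∧
      -- each τ_n = Σ_i τ_{n,i}·1_{G_{n,i}} is a [t,T]-valued F-stopping time
      (∀ n, (∀ ω, (∑ i, (Gs n i).indicator (τs n i) ω) ∈ Set.Icc t T) ∧
        ∀ s ∈ Set.Icc t T,
          MeasurableSet[F s] {ω | (∑ i, (Gs n i).indicator (τs n i) ω) ≤ s}) ∧
      -- τ_n → τ P-almost surely
      (∀ᵐ ω ∂P, Tendsto (fun n => ∑ i, (Gs n i).indicator (τs n i) ω)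
        atTop (nhds (τ ω))) := by
  have hF' : F = fun s => G ⊔ H s := funext hF
  subst hF'
  have happrox := fun n : ℕ => exists_piecewise_stoppingTime_approx P htT hH_le hH_mono hG_le
    hτ_mem hτ_st (δ := (1 / 2) ^ n) (by positivity) (ε := 2⁻¹ ^ n)
    (ENNReal.pow_pos (by simp) n)
  choose N p σ hp hσ hP using happrox
  have hsum : ∀ n ω, ∑ i, (p n ⁻¹' {i}).indicator (σ n i) ω = σ n (p n ω) ω := by
    intro n ω
    rw [Finset.sum_eq_single (p n ω)]
    · simp
    · intro i _ hi
      exact indicator_of_notMem (fun h => hi h.symm) _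
    · simp
  refine ⟨N, σ, fun n i => p n ⁻¹' {i}, hσ, hp, fun n i j hij => ?_, fun n => ?_,
    fun n => ⟨fun ω => ?_, fun s hs => ?_⟩, ?_⟩
  · exact (disjoint_singleton.2 hij).preimage _
  · ext ω
    simp
  · rw [hsum]
    exact (hσ n _).1 ω
  · have h : {ω | ∑ i, (p n ⁻¹' {i}).indicator (σ n i) ω ≤ s} =
        ⋃ i, p n ⁻¹' {i} ∩ {ω | σ n i ω ≤ s} := by
      ext ω
      simp [hsum]
    rw [h]
    exact MeasurableSet.iUnion fun i => ((le_sup_left : G ≤ G ⊔ H s) _ (hp n i)).inter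
      ((le_sup_right : H s ≤ G ⊔ H s) _ ((hσ n i).2 s hs))
  · simp only [hsum]
    have hfin : ∑' n, P {ω | (1 / 2 : ℝ) ^ n < |σ n (p n ω) ω - τ ω|} ≠ ∞ := by
      refine ne_top_of_le_ne_top ?_ (ENNReal.tsum_le_tsum hP)
      simp [ENNReal.tsum_geometric]
    filter_upwards [ae_eventually_notMem hfin] with ω hω
    rw [tendsto_iff_norm_sub_tendsto_zero]
    refine squeeze_zero' (Eventually.of_forall fun n => norm_nonneg _)
      (hω.mono fun n hn => not_lt.1 hn)
      (tendsto_pow_atTop_nhds_zero_of_lt_one (by norm_num) (by norm_num))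
end

section
/- Let t ≤ t_1 < t_2 < … < t_M ≤ T, and for each j let B_j ∈ G and C_j ∈ H_{t_j} be such that the sets A_j := B_j ∩ C_j (j = 1,…,M) form a partition of Ω. Then there exist a finite index set Σ, a family {B^σ}_{σ∈Σ} ⊆ G which is a partition of Ω, and for each σ ∈ Σ a family {C_1^σ,…,C_M^σ} which is a partition of Ω with C_j^σ ∈ H_{t_j} for every j, such that Σ_{j=1}^M t_j·1_{A_j} = Σ_{σ∈Σ} τ^σ·1_{B^σ}, where τ^σ := Σ_{j=1}^M t_j·1_{C_j^σ}; in particular each τ^σ is an H-stopping time with values in [t,T]. -/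
open MeasureTheory Set

/-- A sum of indicators over a pairwise disjoint family picks out the member containing `ω`. -/
theorem sum_indicator_eq_of_mem {Ω ι : Type*} [Fintype ι] {E : ι → Set Ω}
    (hE : Pairwise (Function.onFun Disjoint E)) (f : ι → Ω → ℝ) {ω : Ω} {j : ι}
    (hj : ω ∈ E j) : ∑ i, (E i).indicator (f i) ω = f j ω := by
  rw [Finset.sum_eq_single j, indicator_of_mem hj]
  · intro i _ hij
    exact indicator_of_notMem (fun hi => Set.disjoint_left.mp (hE hij) hi hj) _
  · simp

/-- The sublevel set of a simple function over a partition is a union of its members. -/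
theorem setOf_sum_indicator_le {Ω ι : Type*} [Fintype ι] {E : ι → Set Ω}
    (hE : Pairwise (Function.onFun Disjoint E)) (hE_univ : (⋃ i, E i) = univ) (c : ι → ℝ)
    (s : ℝ) :
    {ω | ∑ i, (E i).indicator (fun _ => c i) ω ≤ s} = ⋃ i, ⋃ _ : c i ≤ s, E i := by
  ext ω
  obtain ⟨j, hj⟩ := mem_iUnion.mp (hE_univ ▸ mem_univ ω)
  simp only [mem_ofPred_eq, sum_indicator_eq_of_mem hE _ hj, mem_iUnion, exists_prop]
  refine ⟨fun h => ⟨j, h, hj⟩, ?_⟩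
  rintro ⟨i, his, hi⟩
  obtain rfl : i = j := by
    by_contra hij
    exact Set.disjoint_left.mp (hE hij) hi hj
  exact his

/-- The atom, indexed by `S`, of the algebra of sets generated by a family `B`. -/
def atomOf {Ω ι : Type*} (B : ι → Set Ω) (S : Finset ι) : Set Ω :=
  {ω | ∀ j, ω ∈ B j ↔ j ∈ S}

theorem pairwise_disjoint_atomOf {Ω ι : Type*} (B : ι → Set Ω) :
    Pairwise (Function.onFun Disjoint (atomOf B)) := by
  intro S S' hS
  refine Set.disjoint_left.mpr fun ω h h' => hS ?_
  ext j
  rw [← h j, h' j]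

theorem iUnion_atomOf {Ω ι : Type*} [Fintype ι] (B : ι → Set Ω) :
    (⋃ S, atomOf B S) = univ := by
  classical
  refine eq_univ_of_forall fun ω => mem_iUnion.mpr ⟨Finset.univ.filter (ω ∈ B ·), fun j => ?_⟩
  simp

theorem measurableSet_atomOf {Ω ι : Type*} [MeasurableSpace Ω] [Countable ι] {B : ι → Set Ω}
    (hB : ∀ j, MeasurableSet (B j)) (S : Finset ι) : MeasurableSet (atomOf B S) := by
  unfold atomOf
  simp only [ofPred_forall]
  exact .iInter fun j => (hB j).iff (.const _)

/-- The sets `C j` with `j ∈ S`, with the member at the greatest index enlarged to the whole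
space. -/
def fillLast {Ω ι : Type*} [LinearOrder ι] (C : ι → Set Ω) (S : Finset ι) (j : ι) : Set Ω :=
  {ω | (j ∈ S ∧ ω ∈ C j) ∨ ∀ i, i ≤ j}

theorem iUnion_fillLast {Ω ι : Type*} [LinearOrder ι] [Finite ι] [Nonempty ι]
    (C : ι → Set Ω) (S : Finset ι) : (⋃ j, fillLast C S j) = univ := by
  obtain ⟨k, hk⟩ := Finite.exists_max (id : ι → ι)
  exact eq_univ_of_forall fun ω => mem_iUnion.mpr ⟨k, Or.inr hk⟩

theorem measurableSet_fillLast {Ω ι : Type*} [MeasurableSpace Ω] [LinearOrder ι]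
    {C : ι → Set Ω} (S : Finset ι) {j : ι} (hC : MeasurableSet (C j)) :
    MeasurableSet (fillLast C S j) :=
  ((MeasurableSet.const _).inter hC).union (.const _)

/-- A point lying in `C j` for exactly one `j ∈ S` belongs to the `j`-th set of the
disjointification of `fillLast C S`. -/
theorem mem_disjointed_fillLast {Ω ι : Type*} [LinearOrder ι] [LocallyFiniteOrderBot ι]
    {C : ι → Set Ω} {S : Finset ι} {ω : Ω} {j : ι} (hjS : j ∈ S) (hj : ω ∈ C j)
    (huniq : ∀ i ∈ S, ω ∈ C i → i = j) : ω ∈ disjointed (fillLast C S) j := by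
  rw [disjointed_apply, Finset.sup_set_eq_biUnion]
  refine ⟨Or.inl ⟨hjS, hj⟩, ?_⟩
  simp only [mem_iUnion, Finset.mem_Iio, exists_prop, not_exists, not_and]
  rintro i hij (⟨hiS, hi⟩ | hlast)
  · exact hij.ne (huniq i hiS hi)
  · exact hij.not_ge (hlast j)

/-- If `A_j = B_j ∩ C_j` (`B_j ∈ G`, `C_j ∈ H_{t_j}`) form a partition of `Ω`, then the
simple stopping time `Σ_j t_j 1_{A_j}` can be rewritten as `Σ_σ τ^σ 1_{B^σ}` where
`{B^σ} ⊆ G` is a partition of `Ω` and each `τ^σ = Σ_j t_j 1_{C_j^σ}` is built from a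
partition `{C_j^σ}` of `Ω` with `C_j^σ ∈ H_{t_j}`; in particular each `τ^σ` is a
`[t,T]`-valued `H`-stopping time. -/
theorem stmt7
    {Ω : Type*} {m𝓕 : MeasurableSpace Ω} (P : Measure Ω) [IsProbabilityMeasure P]
    (t T : ℝ) (ht0 : 0 ≤ t) (htT : t ≤ T)
    (H : ℝ → MeasurableSpace Ω)
    (hH_le : ∀ s ∈ Set.Icc t T, H s ≤ m𝓕)
    (hH_mono : ∀ ⦃s u : ℝ⦄, s ∈ Set.Icc t T → u ∈ Set.Icc t T → s ≤ u → H s ≤ H u)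
    (G : MeasurableSpace Ω) (hG_le : G ≤ m𝓕)
    (M : ℕ) (tj : Fin M → ℝ)
    (htj_mono : StrictMono tj) (htj_mem : ∀ j, tj j ∈ Set.Icc t T)
    (B : Fin M → Set Ω) (hB : ∀ j, MeasurableSet[G] (B j))
    (C : Fin M → Set Ω) (hC : ∀ j, MeasurableSet[H (tj j)] (C j))
    (A : Fin M → Set Ω) (hA : ∀ j, A j = B j ∩ C j)
    (hA_disj : Pairwise (Function.onFun Disjoint A))
    (hA_univ : (⋃ j, A j) = Set.univ) :
    ∃ (K : ℕ) (Bs : Fin K → Set Ω) (Cs : Fin K → Fin M → Set Ω),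
      -- {B^σ} ⊆ G is a partition of Ω
      (∀ σ, MeasurableSet[G] (Bs σ)) ∧
      Pairwise (Function.onFun Disjoint Bs) ∧
      (⋃ σ, Bs σ) = Set.univ ∧
      -- for each σ, {C_1^σ,…,C_M^σ} is a partition of Ω with C_j^σ ∈ H_{t_j}
      (∀ σ j, MeasurableSet[H (tj j)] (Cs σ j)) ∧
      (∀ σ, Pairwise (Function.onFun Disjoint (Cs σ)) ∧ (⋃ j, Cs σ j) = Set.univ) ∧
      -- Σ_j t_j·1_{A_j} = Σ_σ τ^σ·1_{B^σ} with τ^σ = Σ_j t_j·1_{C_j^σ}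
      (∀ ω, (∑ j, (A j).indicator (fun _ => tj j) ω) =
        ∑ σ, (Bs σ).indicator
          (fun ω' => ∑ j, (Cs σ j).indicator (fun _ => tj j) ω') ω) ∧
      -- each τ^σ is a [t,T]-valued H-stopping time
      (∀ σ, (∀ ω, (∑ j, (Cs σ j).indicator (fun _ => tj j) ω) ∈ Set.Icc t T) ∧
        ∀ s ∈ Set.Icc t T,
          MeasurableSet[H s] {ω | (∑ j, (Cs σ j).indicator (fun _ => tj j) ω) ≤ s}) := by
  let e : Fin (Fintype.card (Finset (Fin M))) ≃ Finset (Fin M) := (Fintype.equivFin _).symm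
  let Cs : Finset (Fin M) → Fin M → Set Ω := fun S => disjointed (fillLast C S)
  have hBs_disj : Pairwise (Function.onFun Disjoint fun σ => atomOf B (e σ)) :=
    fun σ σ' h => pairwise_disjoint_atomOf B (e.injective.ne h)
  have hBs_univ : (⋃ σ, atomOf B (e σ)) = univ := by
    rw [e.surjective.iUnion_comp (atomOf B), iUnion_atomOf]
  have hCs_disj : ∀ S, Pairwise (Function.onFun Disjoint (Cs S)) :=
    fun S => disjoint_disjointed _
  have hCs_univ : ∀ S, (⋃ j, Cs S j) = univ := by
    intro S
    refine eq_univ_of_forall fun ω => ?_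
    obtain ⟨j, -⟩ := mem_iUnion.mp (hA_univ ▸ mem_univ ω)
    have : Nonempty (Fin M) := ⟨j⟩
    rw [iUnion_disjointed, iUnion_fillLast]
    exact mem_univ ω
  have hCs_meas : ∀ S j, MeasurableSet[H (tj j)] (Cs S j) := by
    intro S j
    simp only [Cs, disjointed_apply, Finset.sup_set_eq_biUnion]
    let _ : MeasurableSpace Ω := H (tj j)
    refine (measurableSet_fillLast S (hC j)).diff (Finset.measurableSet_biUnion _ fun i hi => ?_)
    exact measurableSet_fillLast S (hH_mono (htj_mem i) (htj_mem j)
      (htj_mono.monotone (Finset.mem_Iio.mp hi).le) _ (hC i))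
  refine ⟨_, fun σ => atomOf B (e σ), fun σ => Cs (e σ),
    fun σ => @measurableSet_atomOf _ _ G _ _ hB _, hBs_disj, hBs_univ, fun σ => hCs_meas _,
    fun σ => ⟨hCs_disj _, hCs_univ _⟩, fun ω => ?_, fun σ => ⟨fun ω => ?_, fun s hs => ?_⟩⟩
  · obtain ⟨j, hj⟩ := mem_iUnion.mp (hA_univ ▸ mem_univ ω)
    obtain ⟨σ, hσ⟩ := mem_iUnion.mp (hBs_univ ▸ mem_univ ω)
    have hjBC : ω ∈ B j ∩ C j := hA j ▸ hj
    have hjCs : ω ∈ Cs (e σ) j := by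
      refine mem_disjointed_fillLast ((hσ j).mp hjBC.1) hjBC.2 fun i hiS hi => ?_
      by_contra hij
      have hiA : ω ∈ A i := hA i ▸ ⟨(hσ i).mpr hiS, hi⟩
      exact Set.disjoint_left.mp (hA_disj hij) hiA hj
    rw [sum_indicator_eq_of_mem hA_disj _ hj, sum_indicator_eq_of_mem hBs_disj _ hσ,
      sum_indicator_eq_of_mem (hCs_disj _) _ hjCs]
  · obtain ⟨j, hj⟩ := mem_iUnion.mp (hCs_univ (e σ) ▸ mem_univ ω)
    rw [sum_indicator_eq_of_mem (hCs_disj _) _ hj]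
    exact htj_mem j
  · rw [setOf_sum_indicator_le (hCs_disj _) (hCs_univ _)]
    exact MeasurableSet.iUnion fun j => .iUnion fun hjs =>
      hH_mono (htj_mem j) hs hjs _ (hCs_meas _ j)
end

section
/- Let (𝓖_n)_{n∈ℕ} be a decreasing sequence of sub-σ-algebras of 𝓕 (𝓖_{n+1} ⊆ 𝓖_n for every n) and set 𝓖 := ⋂_n 𝓖_n. Let Y and (Y_n)_{n∈ℕ} be P-integrable real random variables such that Y_n → Y in L¹(P). Then E[Y_n | 𝓖_n] converges to E[Y | 𝓖] in L¹(P), i.e. E[|E[Y_n|𝓖_n] − E[Y|𝓖]|] → 0 as n → ∞. -/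
open MeasureTheory Filter

/-- Orthogonal projections onto a decreasing family of closed subspaces converge strongly to the
projection onto their intersection. -/
theorem Submodule.starProjection_tendsto_iInf {𝕜 E ι : Type*} [RCLike 𝕜] [NormedAddCommGroup E]
    [InnerProductSpace 𝕜 E] [CompleteSpace E] [Preorder ι] (U : ι → Submodule 𝕜 E)
    [∀ i, (U i).HasOrthogonalProjection] [(⨅ i, U i).HasOrthogonalProjection]
    (hU : Antitone U) (x : E) :
    Tendsto (fun i => (U i).starProjection x) atTop (nhds ((⨅ i, U i).starProjection x)) := by
  have key : (⨆ i, (U i)ᗮ).topologicalClosure = (⨅ i, U i)ᗮ := by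
    rw [← Submodule.orthogonal_orthogonal_eq_closure, ← Submodule.iInf_orthogonal]
    simp only [Submodule.orthogonal_orthogonal]
  have h := Submodule.starProjection_tendsto_closure_iSup (fun i => (U i)ᗮ)
    (fun i j hij => Submodule.orthogonal_le (hU hij)) x
  simp only [key, Submodule.starProjection_orthogonal_val] at h
  simpa using h.const_sub x

namespace MeasureTheory

variable {Ω : Type*} {m0 : MeasurableSpace Ω} {μ : Measure Ω} {m : ℕ → MeasurableSpace Ω}

/-- A real function a.e. equal to an `m n`-measurable function for each `n`, with `m` decreasing,
is a.e. equal to a function measurable with respect to the intersection. -/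
theorem aestronglyMeasurable_iInf_of_antitone (hm : Antitone m) {f : Ω → ℝ}
    (hf : ∀ n, AEStronglyMeasurable[m n] f μ) : AEStronglyMeasurable[⨅ n, m n] f μ := by
  choose g hg hfg using hf
  refine ⟨fun ω => limsup (fun n => g n ω) atTop, ?_, ?_⟩
  · refine Measurable.stronglyMeasurable fun s hs => ?_
    refine MeasurableSpace.measurableSet_iInf.2 fun k => ?_
    have hk : Measurable[m k] fun ω => limsup (fun n => g (n + k) ω) atTop :=
      Measurable.limsup fun n =>
        (hg (n + k)).measurable.mono (hm (Nat.le_add_left k n)) le_rfl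
    simp only [fun ω => limsup_nat_add (fun n => g n ω) k] at hk
    exact hk hs
  · filter_upwards [ae_all_iff.2 hfg] with ω hω
    simp [← hω]

theorem iInf_lpMeas_of_antitone (hm : Antitone m) (p : ENNReal) :
    ⨅ n, lpMeas ℝ ℝ (m n) p μ = lpMeas ℝ ℝ (⨅ n, m n) p μ := by
  ext f
  simp only [Submodule.mem_iInf, mem_lpMeas_iff_aestronglyMeasurable]
  exact ⟨aestronglyMeasurable_iInf_of_antitone hm, fun h n => h.mono (iInf_le m n)⟩

theorem MemLp.tendsto_eLpNorm_two_condExp_iInf [IsFiniteMeasure μ] (hm : Antitone m)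
    (hle : ∀ n, m n ≤ m0) {f : Ω → ℝ} (hf : MemLp f 2 μ) :
    Tendsto (fun n => eLpNorm (μ[f|m n] - μ[f|⨅ k, m k]) 2 μ) atTop (nhds 0) := by
  have hinf : ⨅ k, m k ≤ m0 := (iInf_le m 0).trans (hle 0)
  have : ∀ n, Fact (m n ≤ m0) := fun n => ⟨hle n⟩
  have : Fact (⨅ k, m k ≤ m0) := ⟨hinf⟩
  have : (⨅ n, lpMeas ℝ ℝ (m n) 2 μ).HasOrthogonalProjection := by
    rw [iInf_lpMeas_of_antitone hm]; infer_instance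
  have h := Submodule.starProjection_tendsto_iInf (fun n => lpMeas ℝ ℝ (m n) 2 μ)
    (fun i j hij g hg => mem_lpMeas_iff_aestronglyMeasurable.2
      ((mem_lpMeas_iff_aestronglyMeasurable.1 hg).mono (hm hij))) hf.toLp
  simp only [iInf_lpMeas_of_antitone hm] at h
  refine ((Lp.tendsto_Lp_iff_tendsto_eLpNorm' _ _).1 h).congr fun n => eLpNorm_congr_ae ?_
  exact (hf.condExpL2_ae_eq_condExp (𝕜 := ℝ) (hle n)).sub
    (hf.condExpL2_ae_eq_condExp (𝕜 := ℝ) hinf)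

/-- Convergence in `L¹` of the reverse martingale generated by an integrable function, where
the conditioned function is also allowed to vary. -/
theorem tendsto_eLpNorm_one_condExp_iInf [IsProbabilityMeasure μ] (hm : Antitone m)
    (hle : ∀ n, m n ≤ m0) {f : Ω → ℝ} {F : ℕ → Ω → ℝ} (hf : Integrable f μ)
    (hF : ∀ n, Integrable (F n) μ)
    (hFf : Tendsto (fun n => eLpNorm (F n - f) 1 μ) atTop (nhds 0)) :
    Tendsto (fun n => eLpNorm (μ[F n|m n] - μ[f|⨅ k, m k]) 1 μ) atTop (nhds 0) := by
  have meas : ∀ {m' : MeasurableSpace Ω} {g : Ω → ℝ}, AEStronglyMeasurable[m0] (μ[g|m']) μ :=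
    integrable_condExp.aestronglyMeasurable
  have contr : ∀ (m' : MeasurableSpace Ω) {g h : Ω → ℝ}, Integrable g μ → Integrable h μ →
      eLpNorm (μ[g|m'] - μ[h|m']) 1 μ ≤ eLpNorm (g - h) 1 μ := fun m' g h hg hh =>
    (eLpNorm_congr_ae (condExp_sub hg hh m').symm).trans_le (eLpNorm_condExp_le_eLpNorm _ le_rfl)
  refine ENNReal.tendsto_nhds_zero.2 fun ε hε => ?_
  have hε4 : 0 < ε / 4 := ENNReal.div_pos hε.ne' (by simp)
  obtain ⟨g, hfg, -⟩ := (memLp_one_iff_integrable.2 hf).exists_simpleFunc_eLpNorm_sub_lt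
    ENNReal.one_ne_top hε4.ne'
  have hg2 : MemLp g 2 μ := g.memLp_of_isFiniteMeasure 2 μ
  have hg : Integrable g μ := g.integrable_of_isFiniteMeasure
  filter_upwards [ENNReal.tendsto_nhds_zero.1 hFf _ hε4,
    ENNReal.tendsto_nhds_zero.1 (hg2.tendsto_eLpNorm_two_condExp_iInf hm hle) _ hε4] with n h1 h2
  calc eLpNorm (μ[F n|m n] - μ[f|⨅ k, m k]) 1 μ
      = eLpNorm ((μ[F n|m n] - μ[f|m n]) + (μ[f|m n] - μ[g|m n])
          + (μ[g|m n] - μ[g|⨅ k, m k]) + (μ[g|⨅ k, m k] - μ[f|⨅ k, m k])) 1 μ := by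
        congr 1; abel
    _ ≤ eLpNorm (μ[F n|m n] - μ[f|m n]) 1 μ + eLpNorm (μ[f|m n] - μ[g|m n]) 1 μ
          + eLpNorm (μ[g|m n] - μ[g|⨅ k, m k]) 1 μ
          + eLpNorm (μ[g|⨅ k, m k] - μ[f|⨅ k, m k]) 1 μ := by
        refine (eLpNorm_add_le (((meas.sub meas).add (meas.sub meas)).add (meas.sub meas))
          (meas.sub meas) le_rfl).trans ?_
        gcongr
        refine (eLpNorm_add_le ((meas.sub meas).add (meas.sub meas))
          (meas.sub meas) le_rfl).trans ?_
        gcongr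
        exact eLpNorm_add_le (meas.sub meas) (meas.sub meas) le_rfl
    _ ≤ ε / 4 + ε / 4 + ε / 4 + ε / 4 := by
        gcongr
        · exact (contr _ (hF n) hf).trans h1
        · exact (contr _ hf hg).trans hfg.le
        · exact (eLpNorm_le_eLpNorm_of_exponent_le one_le_two (meas.sub meas)).trans h2
        · exact (contr _ hg hf).trans ((eLpNorm_sub_comm _ _ _ _).trans_le hfg.le)
    _ = ε := by
        rw [show ε / 4 + ε / 4 + ε / 4 + ε / 4 = 4 * (ε / 4) by ring]
        exact ENNReal.mul_div_cancel (by simp) (by simp)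

theorem Integrable.tendsto_integral_abs_iff {ι : Type*} {l : Filter ι} {f : ι → Ω → ℝ}
    (hf : ∀ i, Integrable (f i) μ) :
    Tendsto (fun i => ∫ ω, |f i ω| ∂μ) l (nhds 0)
      ↔ Tendsto (fun i => eLpNorm (f i) 1 μ) l (nhds 0) := by
  rw [← ENNReal.tendsto_toReal_zero_iff fun i => (memLp_one_iff_integrable.2 (hf i)).2.ne]
  simp only [eLpNorm_one_eq_lintegral_enorm, ← Real.norm_eq_abs,
    fun i => integral_norm_eq_lintegral_enorm (hf i).aestronglyMeasurable]

end MeasureTheory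

/-- Backward-martingale-type convergence of conditional expectations: if `(𝓖_n)` is a
decreasing sequence of sub-σ-algebras with intersection `𝓖 = ⋂_n 𝓖_n`, and `Y_n → Y`
in `L¹(P)`, then `E[Y_n | 𝓖_n] → E[Y | 𝓖]` in `L¹(P)`. -/
theorem stmt11
    {Ω : Type*} {m𝓕 : MeasurableSpace Ω} (P : Measure Ω) [IsProbabilityMeasure P]
    (𝓖 : ℕ → MeasurableSpace Ω)
    (h𝓖_le : ∀ n, 𝓖 n ≤ m𝓕)
    (h𝓖_dec : ∀ n, 𝓖 (n + 1) ≤ 𝓖 n)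
    (Y : Ω → ℝ) (Yn : ℕ → Ω → ℝ)
    (hY : Integrable Y P) (hYn : ∀ n, Integrable (Yn n) P)
    (hconv : Tendsto (fun n => ∫ ω, |Yn n ω - Y ω| ∂P) atTop (nhds 0)) :
    Tendsto (fun n => ∫ ω, |(P[Yn n|𝓖 n]) ω - (P[Y|⨅ k, 𝓖 k]) ω| ∂P)
      atTop (nhds 0) := by
  have hm : Antitone 𝓖 := antitone_nat_of_succ_le h𝓖_dec
  exact (Integrable.tendsto_integral_abs_iff fun n => integrable_condExp.sub integrable_condExp).2
    (tendsto_eLpNorm_one_condExp_iInf hm h𝓖_le hY hYn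
      ((Integrable.tendsto_integral_abs_iff fun n => (hYn n).sub hY).1 hconv))
end
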